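/- arXiv:1801.03390 — 5 statements merged into one kernel-verified Lean document; each statement's English description precedes it below -/
import Mathlib

section
/- Let μ_1,…,μ_k and λ_1,…,λ_k be complex numbers with μ_j ≠ λ_i for all j, i, and let v_1,…,v_k and w_1,…,w_k be complex numbers. Define 𝕃, 𝕃_s ∈ ℂ^{k×k} by 𝕃_{ji} = (v_j − w_i)/(μ_j − λ_i) and (𝕃_s)_{ji} = (μ_j v_j − λ_i w_i)/(μ_j − λ_i), let V ∈ ℂ^{k×1} have entries v_j and W ∈ ℂ^{1×k} have entries w_i, and define the transfer function G(z) = W (𝕃_s − z𝕃)^{-1} V. Then G interpolates the right data: for each index i, if the matrix 𝕃_s − λ_i 𝕃 is invertible, then W (𝕃_s − λ_i 𝕃)^{-1} V = w_i. -/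
open Matrix

/-- The Loewner realization transfer function `G(z) = W(𝕃_s − z𝕃)⁻¹V`
interpolates the right data: `G(λ_i) = w_i`. -/
theorem loewner_right_interpolation {k : ℕ} (μ lam : Fin k → ℂ)
    (v w : Fin k → ℂ)
    (hne : ∀ j i, μ j ≠ lam i)
    (L Ls : Matrix (Fin k) (Fin k) ℂ)
    (hL : ∀ j i, L j i = (v j - w i) / (μ j - lam i))
    (hLs : ∀ j i, Ls j i = (μ j * v j - lam i * w i) / (μ j - lam i))
    (V : Matrix (Fin k) (Fin 1) ℂ) (hV : ∀ j, V j 0 = v j)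
    (W : Matrix (Fin 1) (Fin k) ℂ) (hW : ∀ i, W 0 i = w i) :
    ∀ i : Fin k, IsUnit (Ls - lam i • L) →
      (W * (Ls - lam i • L)⁻¹ * V) 0 0 = w i := by
  intro i hu
  have hdet : IsUnit (Ls - lam i • L).det := (Matrix.isUnit_iff_isUnit_det _).mp hu
  have key : V = (Ls - lam i • L) * Matrix.single i (0 : Fin 1) (1 : ℂ) := by
    ext j c
    have hc : c = 0 := Subsingleton.elim _ _
    subst hc
    have h : μ j - lam i ≠ 0 := sub_ne_zero.mpr (hne j i)
    rw [Matrix.mul_single_apply_same, Matrix.sub_apply, Matrix.smul_apply, hL, hLs, hV, smul_eq_mul]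
    field_simp
    ring
  rw [Matrix.mul_assoc, key, Matrix.nonsing_inv_mul_cancel_left _ _ hdet,
    Matrix.mul_single_apply_same, hW, mul_one]
end

section
/- Let μ_1,…,μ_k and λ_1,…,λ_k be complex numbers with μ_j ≠ λ_i for all j, i, and let v_1,…,v_k and w_1,…,w_k be complex numbers. Define 𝕃, 𝕃_s ∈ ℂ^{k×k} by 𝕃_{ji} = (v_j − w_i)/(μ_j − λ_i) and (𝕃_s)_{ji} = (μ_j v_j − λ_i w_i)/(μ_j − λ_i), let V ∈ ℂ^{k×1} have entries v_j and W ∈ ℂ^{1×k} have entries w_i, and define the transfer function G(z) = W (𝕃_s − z𝕃)^{-1} V. Then G interpolates the left data: for each index j, if the matrix 𝕃_s − μ_j 𝕃 is invertible, then W (𝕃_s − μ_j 𝕃)^{-1} V = v_j. -/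
open Matrix

/-- The Loewner realization transfer function `G(z) = W(𝕃_s − z𝕃)⁻¹V`
interpolates the left data: `G(μ_j) = v_j`. -/
theorem loewner_left_interpolation {k : ℕ} (μ lam : Fin k → ℂ)
    (v w : Fin k → ℂ)
    (hne : ∀ j i, μ j ≠ lam i)
    (L Ls : Matrix (Fin k) (Fin k) ℂ)
    (hL : ∀ j i, L j i = (v j - w i) / (μ j - lam i))
    (hLs : ∀ j i, Ls j i = (μ j * v j - lam i * w i) / (μ j - lam i))
    (V : Matrix (Fin k) (Fin 1) ℂ) (hV : ∀ j, V j 0 = v j)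
    (W : Matrix (Fin 1) (Fin k) ℂ) (hW : ∀ i, W 0 i = w i) :
    ∀ j : Fin k, IsUnit (Ls - μ j • L) →
      (W * (Ls - μ j • L)⁻¹ * V) 0 0 = v j := by
  intro j hU
  have hdet : IsUnit (Ls - μ j • L).det := (Matrix.isUnit_iff_isUnit_det _).1 hU
  have hrow : W = Matrix.single (0 : Fin 1) j (1 : ℂ) * (Ls - μ j • L) := by
    ext a i
    obtain rfl : a = 0 := Subsingleton.elim _ _
    have h : μ j - lam i ≠ 0 := sub_ne_zero.2 (hne j i)
    rw [Matrix.single_mul_apply_same, hW, Matrix.sub_apply, Matrix.smul_apply, hL, hLs,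
      smul_eq_mul]
    field_simp
    ring
  have h2 : W * (Ls - μ j • L)⁻¹ = Matrix.single (0 : Fin 1) j (1 : ℂ) := by
    conv_lhs => rw [hrow]
    rw [Matrix.mul_assoc, Matrix.mul_nonsing_inv _ hdet, Matrix.mul_one]
  rw [h2, Matrix.single_mul_apply_same, hV, one_mul]
end

section
/- Let E, A ∈ ℂ^{n×n}, B ∈ ℂ^{n×1}, and let λ_1,…,λ_k ∈ ℂ be such that λ_i E − A is invertible for every i. Define the generalized controllability matrix ℛ ∈ ℂ^{n×k} whose i-th column is Φ(λ_i)B, where Φ(s) = (sE − A)^{-1}, and let Λ = diag(λ_1,…,λ_k) and e_k be the all-ones vector of length k. Then ℛ satisfies the Sylvester equation E ℛ Λ − A ℛ = B e_k^T. -/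
open Matrix

/-- The generalized controllability matrix `ℛ` (with columns `Φ(λ_i)B`) satisfies the
Sylvester equation `E ℛ Λ − A ℛ = B e_kᵀ`. -/
theorem controllability_sylvester {n k : ℕ}
    (E A : Matrix (Fin n) (Fin n) ℂ) (B : Matrix (Fin n) (Fin 1) ℂ)
    (lam : Fin k → ℂ) (hinv : ∀ i, IsUnit (lam i • E - A))
    (R : Matrix (Fin n) (Fin k) ℂ)
    (hR : ∀ (x : Fin n) (i : Fin k), R x i = ((lam i • E - A)⁻¹ * B) x 0)
    (Λ : Matrix (Fin k) (Fin k) ℂ) (hΛ : Λ = Matrix.diagonal lam)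
    (ek : Matrix (Fin k) (Fin 1) ℂ) (hek : ∀ i, ek i 0 = 1) :
    E * R * Λ - A * R = B * ekᵀ := by
  subst hΛ
  ext x i
  have h1 : (lam i • E - A) * ((lam i • E - A)⁻¹ * B) = B :=
    Matrix.mul_nonsing_inv_cancel_left _ _ ((Matrix.isUnit_iff_isUnit_det _).mp (hinv i))
  have h2 := congrFun (congrFun h1 x) 0
  have h3 : (B * ekᵀ) x i = B x 0 := by
    simp [Matrix.mul_apply, hek]
  rw [h3, ← h2, Matrix.sub_apply, Matrix.mul_diagonal, Matrix.mul_apply, Matrix.mul_apply,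
    Matrix.mul_apply, Finset.sum_mul, ← Finset.sum_sub_distrib]
  refine Finset.sum_congr rfl fun y _ => ?_
  rw [hR y i, Matrix.sub_apply, Matrix.smul_apply, smul_eq_mul]
  ring
end

section
/- Let E, A ∈ ℂ^{n×n}, B ∈ ℂ^{n×1}, C ∈ ℂ^{1×n}, and let μ_1,…,μ_q, λ_1,…,λ_k ∈ ℂ be such that μ_j E − A and λ_i E − A are invertible for all j, i and μ_j ≠ λ_i for all pairs. Set v_j = CΦ(μ_j)B and w_i = CΦ(λ_i)B where Φ(s) = (sE − A)^{-1}, and let 𝕃 ∈ ℂ^{q×k} be the Loewner matrix 𝕃_{ji} = (v_j − w_i)/(μ_j − λ_i). Then 𝕃 = −𝒪 E ℛ, where 𝒪 is the generalized observability matrix with rows CΦ(μ_j) and ℛ is the generalized controllability matrix with columns Φ(λ_i)B. -/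
open Matrix

/-- The Loewner matrix built from transfer-function samples factors as `𝕃 = −𝒪 E ℛ`. -/
theorem loewner_factorization {n q k : ℕ}
    (E A : Matrix (Fin n) (Fin n) ℂ)
    (B : Matrix (Fin n) (Fin 1) ℂ) (C : Matrix (Fin 1) (Fin n) ℂ)
    (μ : Fin q → ℂ) (lam : Fin k → ℂ)
    (hμ : ∀ j, IsUnit (μ j • E - A)) (hlam : ∀ i, IsUnit (lam i • E - A))
    (hne : ∀ j i, μ j ≠ lam i)
    (v : Fin q → ℂ) (hv : ∀ j, v j = (C * (μ j • E - A)⁻¹ * B) 0 0)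
    (w : Fin k → ℂ) (hw : ∀ i, w i = (C * (lam i • E - A)⁻¹ * B) 0 0)
    (L : Matrix (Fin q) (Fin k) ℂ)
    (hL : ∀ j i, L j i = (v j - w i) / (μ j - lam i))
    (O : Matrix (Fin q) (Fin n) ℂ)
    (hO : ∀ (j : Fin q) (x : Fin n), O j x = (C * (μ j • E - A)⁻¹) 0 x)
    (R : Matrix (Fin n) (Fin k) ℂ)
    (hR : ∀ (x : Fin n) (i : Fin k), R x i = ((lam i • E - A)⁻¹ * B) x 0) :
    L = -(O * E * R) := by
  ext j i
  have hM := (Matrix.isUnit_iff_isUnit_det _).1 (hμ j)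
  have hN := (Matrix.isUnit_iff_isUnit_det _).1 (hlam i)
  have key : (μ j • E - A)⁻¹ - (lam i • E - A)⁻¹
      = (lam i - μ j) • ((μ j • E - A)⁻¹ * E * (lam i • E - A)⁻¹) := by
    have h1 : (lam i - μ j) • E = (lam i • E - A) - (μ j • E - A) := by
      rw [sub_smul]; abel
    rw [← Matrix.smul_mul, ← Matrix.mul_smul, h1, Matrix.mul_sub, Matrix.sub_mul,
      Matrix.nonsing_inv_mul _ hM, Matrix.mul_assoc, Matrix.mul_nonsing_inv _ hN,
      Matrix.mul_one, Matrix.one_mul]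
  have hent : (O * E * R) j i
      = (C * (μ j • E - A)⁻¹ * E * ((lam i • E - A)⁻¹ * B)) 0 0 := by
    simp only [Matrix.mul_apply (M := O * E), Matrix.mul_apply (M := O),
      Matrix.mul_apply (M := C * (μ j • E - A)⁻¹ * E),
      Matrix.mul_apply (M := C * (μ j • E - A)⁻¹), hO, hR]
  have hvw : v j - w i = (lam i - μ j) * (O * E * R) j i := by
    rw [hent, hv, hw, ← Matrix.sub_apply, ← Matrix.sub_mul, ← Matrix.mul_sub, key,
      Matrix.mul_smul, Matrix.smul_mul, Matrix.smul_apply, smul_eq_mul]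
    simp only [Matrix.mul_assoc]
  have h0 : μ j - lam i ≠ 0 := sub_ne_zero.2 (hne j i)
  rw [hL, hvw, Matrix.neg_apply, div_eq_iff h0]
  ring
end

section
/- Let E, A ∈ ℂ^{n×n}, B ∈ ℂ^{n×1}, C ∈ ℂ^{1×n}, and let μ_1,…,μ_q, λ_1,…,λ_k ∈ ℂ be such that μ_j E − A and λ_i E − A are invertible for all j, i and μ_j ≠ λ_i for all pairs. Set v_j = CΦ(μ_j)B and w_i = CΦ(λ_i)B where Φ(s) = (sE − A)^{-1}, and let 𝕃_s ∈ ℂ^{q×k} be the shifted Loewner matrix (𝕃_s)_{ji} = (μ_j v_j − λ_i w_i)/(μ_j − λ_i). Then 𝕃_s = −𝒪 A ℛ, where 𝒪 is the generalized observability matrix with rows CΦ(μ_j) and ℛ is the generalized controllability matrix with columns Φ(λ_i)B. -/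
open Matrix

/-- The shifted Loewner matrix built from transfer-function samples factors as
`𝕃_s = −𝒪 A ℛ`. -/
theorem shifted_loewner_factorization {n q k : ℕ}
    (E A : Matrix (Fin n) (Fin n) ℂ)
    (B : Matrix (Fin n) (Fin 1) ℂ) (C : Matrix (Fin 1) (Fin n) ℂ)
    (μ : Fin q → ℂ) (lam : Fin k → ℂ)
    (hμ : ∀ j, IsUnit (μ j • E - A)) (hlam : ∀ i, IsUnit (lam i • E - A))
    (hne : ∀ j i, μ j ≠ lam i)
    (v : Fin q → ℂ) (hv : ∀ j, v j = (C * (μ j • E - A)⁻¹ * B) 0 0)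
    (w : Fin k → ℂ) (hw : ∀ i, w i = (C * (lam i • E - A)⁻¹ * B) 0 0)
    (Ls : Matrix (Fin q) (Fin k) ℂ)
    (hLs : ∀ j i, Ls j i = (μ j * v j - lam i * w i) / (μ j - lam i))
    (O : Matrix (Fin q) (Fin n) ℂ)
    (hO : ∀ (j : Fin q) (x : Fin n), O j x = (C * (μ j • E - A)⁻¹) 0 x)
    (R : Matrix (Fin n) (Fin k) ℂ)
    (hR : ∀ (x : Fin n) (i : Fin k), R x i = ((lam i • E - A)⁻¹ * B) x 0) :
    Ls = -(O * A * R) := by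
  ext j i
  have hM := (Matrix.isUnit_iff_isUnit_det _).1 (hμ j)
  have hN := (Matrix.isUnit_iff_isUnit_det _).1 (hlam i)
  have hd : μ j - lam i ≠ 0 := sub_ne_zero.2 (hne j i)
  have key : μ j • (μ j • E - A)⁻¹ - lam i • (lam i • E - A)⁻¹
      = -((μ j - lam i) • ((μ j • E - A)⁻¹ * A * (lam i • E - A)⁻¹)) := by
    have h1 : μ j • (lam i • E - A) - lam i • (μ j • E - A) = -((μ j - lam i) • A) := by
      rw [smul_sub, smul_sub, smul_smul, smul_smul, mul_comm (lam i), sub_smul]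
      abel
    have h2 : (μ j • E - A)⁻¹ * (μ j • (lam i • E - A) - lam i • (μ j • E - A))
        * (lam i • E - A)⁻¹ = μ j • (μ j • E - A)⁻¹ - lam i • (lam i • E - A)⁻¹ := by
      generalize μ j • E - A = M at *
      generalize lam i • E - A = N at *
      rw [Matrix.mul_sub, Matrix.sub_mul, Matrix.mul_smul, Matrix.mul_smul, Matrix.smul_mul,
        Matrix.smul_mul, Matrix.nonsing_inv_mul _ hM, Matrix.mul_assoc,
        Matrix.mul_nonsing_inv _ hN, Matrix.mul_one, Matrix.one_mul]
    rw [← h2, h1, Matrix.mul_neg, Matrix.neg_mul, Matrix.mul_smul, Matrix.smul_mul]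
  have hent : (O * A * R) j i
      = (C * ((μ j • E - A)⁻¹ * A * (lam i • E - A)⁻¹) * B) 0 0 := by
    have e : C * ((μ j • E - A)⁻¹ * A * (lam i • E - A)⁻¹) * B
        = (C * (μ j • E - A)⁻¹) * A * ((lam i • E - A)⁻¹ * B) := by
      simp only [Matrix.mul_assoc]
    rw [e, Matrix.mul_apply, Matrix.mul_apply]
    refine Finset.sum_congr rfl fun x _ => ?_
    rw [hR, Matrix.mul_apply (M := O), Matrix.mul_apply (N := A) (M := C * _)]
    simp only [hO]
  rw [Matrix.neg_apply, hent, hLs, hv, hw, div_eq_iff hd]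
  generalize (μ j • E - A)⁻¹ * A * (lam i • E - A)⁻¹ = Q at *
  generalize (μ j • E - A)⁻¹ = X at *
  generalize (lam i • E - A)⁻¹ = Y at *
  have h3 := congrArg (fun Z => (C * Z * B) 0 0) key
  simp only [Matrix.mul_sub, Matrix.sub_mul, Matrix.mul_smul, Matrix.smul_mul,
    Matrix.mul_neg, Matrix.neg_mul, Matrix.sub_apply, Matrix.smul_apply, Matrix.neg_apply,
    smul_eq_mul] at h3
  rw [h3]
  ring
end
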